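/- arXiv:2002.00836 — 4 statements merged into one kernel-verified Lean document; each statement's English description precedes it below -/
import Mathlib

section
/- Let G = (U,A) be a finite simple d-regular graph with m = |A| edges, let κ be an integer with m > d > κ > 2, and let r ≥ 2 be an integer. Consider the approval election with candidate set C = U ∪ {p}, p ∉ U, whose votes are: d − κ + 2 votes each equal to U (i.e., approving all candidates except p), and for each edge {u,u'} ∈ A one vote equal to (U ∪ {p})∖{u,u'}. Then it is possible to select at most κ(κ−1)/2 votes and replace each selected vote v by a vote v' with v ⊆ v' ⊆ C and |v'∖v| ≤ r, so that in the resulting election p belongs to no winning κ-committee under AV, if and only if G has a clique of size κ. -/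
namespace ApprovalBribery

variable {α : Type*} [DecidableEq α]

/-- AV score of a candidate: number of votes approving it. -/
def avScore (V : Multiset (Finset α)) (c : α) : ℕ :=
  (V.map fun v => if c ∈ v then 1 else 0).sum

/-- AV score of a committee. -/
def avCom (V : Multiset (Finset α)) (w : Finset α) : ℕ :=
  (V.map fun v => (v ∩ w).card).sum

/-- SAV score of a candidate. -/
def savScore (V : Multiset (Finset α)) (c : α) : ℚ :=
  (V.map fun v => if c ∈ v then ((v.card : ℚ))⁻¹ else 0).sum

/-- NSAV score of a candidate in an election with candidate set `C`. -/
def nsavScore (C : Finset α) (V : Multiset (Finset α)) (c : α) : ℚ :=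
  savScore V c -
    (V.map fun v => if c ∉ v ∧ v ≠ C then ((C.card : ℚ) - (v.card : ℚ))⁻¹ else 0).sum

/-- SAV score of a committee. -/
def savCom (V : Multiset (Finset α)) (w : Finset α) : ℚ :=
  (V.map fun v => ((v ∩ w).card : ℚ) / (v.card : ℚ)).sum

/-- CCAV score of a committee. -/
def ccavCom (V : Multiset (Finset α)) (w : Finset α) : ℕ :=
  (V.map fun v => if v ∩ w ≠ ∅ then 1 else 0).sum

/-- PAV score of a committee. -/
def pavCom (V : Multiset (Finset α)) (w : Finset α) : ℚ :=
  (V.map fun v => ∑ i ∈ Finset.range (v ∩ w).card, ((i : ℚ) + 1)⁻¹).sum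

/-- `w` is a winning `k`-committee for the scoring function `score` in an election
with candidate set `C`. -/
def IsWinningCommittee {β : Type*} [Preorder β] (C : Finset α) (k : ℕ)
    (score : Finset α → β) (w : Finset α) : Prop :=
  w ⊆ C ∧ w.card = k ∧ ∀ w' ⊆ C, w'.card = k → score w' ≤ score w

/-- `V'` is obtained from `V` by performing at most `ℓ` single approval additions,
each of which inserts one candidate of `C` into one vote not already containing it. -/
def ApprovalAdds (C : Finset α) (V V' : Multiset (Finset α)) (ℓ : ℕ) : Prop :=
  ∃ P : Multiset (Finset α × Finset α),
    V = P.map Prod.fst ∧ V' = P.map Prod.snd ∧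
    (∀ q ∈ P, q.1 ⊆ q.2 ∧ q.2 ⊆ C) ∧
    (P.map fun q => (q.2 \ q.1).card).sum ≤ ℓ

/-- `V'` is obtained from `V` by performing at most `ℓ` single approval deletions,
each of which removes one candidate from one vote containing it. -/
def ApprovalDels (V V' : Multiset (Finset α)) (ℓ : ℕ) : Prop :=
  ∃ P : Multiset (Finset α × Finset α),
    V = P.map Prod.fst ∧ V' = P.map Prod.snd ∧
    (∀ q ∈ P, q.2 ⊆ q.1) ∧
    (P.map fun q => (q.1 \ q.2).card).sum ≤ ℓ

/-- `V'` is obtained from `V` by selecting at most `ℓ` votes and replacing each selected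
vote by an arbitrary vote over `C` within Hamming distance `r` of it. -/
def VoteChanges (C : Finset α) (V V' : Multiset (Finset α)) (ℓ r : ℕ) : Prop :=
  ∃ P : Multiset (Finset α × Finset α),
    V = P.map Prod.fst ∧ V' = P.map Prod.snd ∧
    (∀ q ∈ P, q.1 = q.2 ∨ (q.2 ⊆ C ∧ (q.1 \ q.2).card + (q.2 \ q.1).card ≤ r)) ∧
    P.countP (fun q => q.1 ≠ q.2) ≤ ℓ

/-- `V'` is obtained from `V` by selecting at most `ℓ` votes and replacing each selected
vote `v` by a vote `v'` with `v ⊆ v' ⊆ C` and `|v' \ v| ≤ r`. -/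
def VoteAdditionChanges (C : Finset α) (V V' : Multiset (Finset α)) (ℓ r : ℕ) : Prop :=
  ∃ P : Multiset (Finset α × Finset α),
    V = P.map Prod.fst ∧ V' = P.map Prod.snd ∧
    (∀ q ∈ P, q.1 = q.2 ∨ (q.1 ⊆ q.2 ∧ q.2 ⊆ C ∧ (q.2 \ q.1).card ≤ r)) ∧
    P.countP (fun q => q.1 ≠ q.2) ≤ ℓ

/-- `V'` is obtained from `V` by selecting at most `ℓ` votes and replacing each selected
vote `v` by a vote `v'` with `v' ⊆ v` and `|v \ v'| ≤ r`. -/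
def VoteDeletionChanges (V V' : Multiset (Finset α)) (ℓ r : ℕ) : Prop :=
  ∃ P : Multiset (Finset α × Finset α),
    V = P.map Prod.fst ∧ V' = P.map Prod.snd ∧
    (∀ q ∈ P, q.1 = q.2 ∨ (q.2 ⊆ q.1 ∧ (q.1 \ q.2).card ≤ r)) ∧
    P.countP (fun q => q.1 ≠ q.2) ≤ ℓ

/-- `(X, 𝒞)` is an RX3C instance with `|X| = 3κ`: `𝒞` is a collection of `3κ` many
3-element subsets of `X` and every element of `X` belongs to exactly three members of `𝒞`. -/
def IsRX3C (X : Finset α) (𝒞 : Finset (Finset α)) (κ : ℕ) : Prop :=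
  X.card = 3 * κ ∧ 𝒞.card = 3 * κ ∧ (∀ H ∈ 𝒞, H ⊆ X ∧ H.card = 3) ∧
  ∀ x ∈ X, (𝒞.filter fun H => x ∈ H).card = 3

/-- `𝒞` contains an exact cover of `X`: a subcollection `𝒞' ⊆ 𝒞` such that every element
of `X` belongs to exactly one member of `𝒞'`. -/
def HasExactCover (X : Finset α) (𝒞 : Finset (Finset α)) : Prop :=
  ∃ 𝒞' ⊆ 𝒞, ∀ x ∈ X, (𝒞'.filter fun H => x ∈ H).card = 1

theorem sum_map_ite_eq_countP {β : Type*} (P : Multiset β) (p : β → Prop) [DecidablePred p] :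
    (P.map fun q => if p q then 1 else 0).sum = P.countP p := by
  induction P using Multiset.induction_on with
  | empty => simp
  | cons q P ih => simp [Multiset.countP_cons, add_comm, ih]

theorem avCom_eq_sum_avScore (V : Multiset (Finset α)) (w : Finset α) :
    avCom V w = ∑ c ∈ w, avScore V c := by
  induction V using Multiset.induction_on with
  | empty => simp [avScore, avCom]
  | cons v V ih =>
    simp only [avScore, avCom, Multiset.map_cons, Multiset.sum_cons,
      Finset.sum_add_distrib] at ih ⊢
    rw [ih, Finset.inter_comm, ← Finset.filter_mem_eq_inter, Finset.card_filter]

theorem avScore_map_snd (P : Multiset (Finset α × Finset α)) (hP : ∀ q ∈ P, q.1 ⊆ q.2) (c : α) :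
    avScore (P.map Prod.snd) c =
      avScore (P.map Prod.fst) c + (P.map fun q => if c ∉ q.1 ∧ c ∈ q.2 then 1 else 0).sum := by
  induction P using Multiset.induction_on with
  | empty => simp [avScore]
  | cons q P ih =>
    have hq : q.1 ⊆ q.2 := hP q (Multiset.mem_cons_self q P)
    have ih := ih fun x hx => hP x (Multiset.mem_cons_of_mem hx)
    simp only [avScore, Multiset.map_cons, Multiset.sum_cons] at ih ⊢
    rw [ih]
    by_cases h1 : c ∈ q.1
    · simp [h1, hq h1, add_assoc]
    · simp [h1]; omega

/-- Exchanging `a` for `b` in a committee exchanges their scores. -/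
theorem avCom_swap (V : Multiset (Finset α)) {w : Finset α} {a b : α} (ha : a ∈ w) (hb : b ∉ w) :
    avCom V (insert b (w.erase a)) + avScore V a = avCom V w + avScore V b := by
  have hb' : b ∉ w.erase a := fun h => hb (Finset.mem_of_mem_erase h)
  rw [avCom_eq_sum_avScore, avCom_eq_sum_avScore, Finset.sum_insert hb',
    ← Finset.add_sum_erase w _ ha]
  omega

theorem card_swap {w : Finset α} {a b : α} (ha : a ∈ w) (hb : b ∉ w) :
    (insert b (w.erase a)).card = w.card := by
  have hb' : b ∉ w.erase a := fun h => hb (Finset.mem_of_mem_erase h)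
  rw [Finset.card_insert_of_notMem hb', Finset.card_erase_add_one ha]

theorem exists_isWinningCommittee {β : Type*} {C : Finset β} {k : ℕ} (hk : k ≤ C.card)
    (score : Finset β → ℕ) : ∃ w, IsWinningCommittee C k score w := by
  obtain ⟨w, hw, hmax⟩ := Finset.exists_max_image (C.powersetCard k) score
    (Finset.powersetCard_nonempty.2 hk)
  rw [Finset.mem_powersetCard] at hw
  exact ⟨w, hw.1, hw.2, fun w' h1 h2 => hmax w' (Finset.mem_powersetCard.2 ⟨h1, h2⟩)⟩

/-- A candidate lies in no winning `k`-committee iff at least `k` candidates beat it strictly. -/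
theorem forall_isWinningCommittee_notMem_iff [Fintype α] {k : ℕ} (hk : k ≤ Fintype.card α)
    (V : Multiset (Finset α)) (p : α) :
    (∀ w, IsWinningCommittee Finset.univ k (avCom V) w → p ∉ w) ↔
      ∃ w : Finset α, w.card = k ∧ ∀ c ∈ w, avScore V p < avScore V c := by
  constructor
  · intro h
    obtain ⟨w, hw⟩ := exists_isWinningCommittee (C := (Finset.univ : Finset α)) hk (avCom V)
    have hp := h w hw
    refine ⟨w, hw.2.1, fun c hc => ?_⟩
    by_contra! hle
    refine h (insert p (w.erase c)) ⟨Finset.subset_univ _, ?_, fun w' h1 h2 => ?_⟩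
      (Finset.mem_insert_self _ _)
    · rw [card_swap hc hp, hw.2.1]
    · have := hw.2.2 w' h1 h2
      have := avCom_swap V hc hp
      omega
  · rintro ⟨S, hS, hlt⟩ w ⟨-, hw, hmax⟩ hp
    have hns : ¬ S ⊆ w := fun hsub => by
      have := Finset.eq_of_subset_of_card_le hsub (by omega)
      exact lt_irrefl _ (hlt p (this ▸ hp))
    obtain ⟨c, hcS, hcw⟩ := Finset.not_subset.1 hns
    have h1 := hmax (insert c (w.erase p)) (Finset.subset_univ _) (by rw [card_swap hp hcw, hw])
    have h2 := avCom_swap V hp hcw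
    have h3 := hlt c hcS
    omega

section Graph

variable {U : Type*} [DecidableEq U]

/-- The pairs of distinct elements of `S`. -/
def pairs (S : Finset U) : Finset (Sym2 U) :=
  S.offDiag.image fun x => s(x.1, x.2)

theorem card_pairs (S : Finset U) : (pairs S).card = S.card.choose 2 :=
  Sym2.card_image_offDiag S

theorem mk_mem_pairs {S : Finset U} {a b : U} :
    s(a, b) ∈ pairs S ↔ a ∈ S ∧ b ∈ S ∧ a ≠ b := by
  simp only [pairs, Finset.mem_image, Finset.mem_offDiag, Prod.exists, Sym2.eq_iff]
  constructor
  · rintro ⟨x, y, ⟨hx, hy, hxy⟩, ⟨rfl, rfl⟩ | ⟨rfl, rfl⟩⟩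
    · exact ⟨hx, hy, hxy⟩
    · exact ⟨hy, hx, hxy.symm⟩
  · intro h
    exact ⟨a, b, h, Or.inl ⟨rfl, rfl⟩⟩

variable [Fintype U]

/-- The vote approving everybody except the endpoints of `e`. -/
def edgeVote (e : Sym2 U) : Finset (U ⊕ Unit) :=
  Finset.univ \ ((Finset.univ.filter (· ∈ e)).image (Sum.inl : U → U ⊕ Unit))

theorem inl_mem_edgeVote (e : Sym2 U) (u : U) : Sum.inl u ∈ edgeVote e ↔ u ∉ e := by
  simp [edgeVote]

theorem inr_mem_edgeVote (e : Sym2 U) (x : Unit) : Sum.inr x ∈ edgeVote e := by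
  simp [edgeVote]

/-- The votes of the election built from `G`, with `t` votes approving all of `U`. -/
def graphVotes (G : SimpleGraph U) [DecidableRel G.Adj] (t : ℕ) :
    Multiset (Finset (U ⊕ Unit)) :=
  Multiset.replicate t (Finset.univ \ {(Sum.inr () : U ⊕ Unit)}) + G.edgeFinset.val.map edgeVote

variable (G : SimpleGraph U) [DecidableRel G.Adj] {d : ℕ}

theorem card_filter_notMem_edgeFinset (hreg : G.IsRegularOfDegree d) (u : U) :
    (G.edgeFinset.filter fun e => u ∉ e).card + d = G.edgeFinset.card := by
  have h1 := Finset.card_filter_add_card_filter_not (s := G.edgeFinset) (fun e => u ∈ e)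
  have h2 := G.card_incidenceFinset_eq_degree u
  rw [G.incidenceFinset_eq_filter, hreg u] at h2
  omega

theorem avScore_graphVotes_inr (t : ℕ) :
    avScore (graphVotes G t) (Sum.inr ()) = G.edgeFinset.card := by
  simp [avScore, graphVotes, inr_mem_edgeVote]

theorem avScore_graphVotes_inl (hreg : G.IsRegularOfDegree d) (t : ℕ) (u : U) :
    avScore (graphVotes G t) (Sum.inl u) + d = t + G.edgeFinset.card := by
  rw [← card_filter_notMem_edgeFinset G hreg u, Finset.card_filter]
  simp [avScore, graphVotes, inl_mem_edgeVote, add_assoc]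

theorem pairs_subset_edgeFinset_iff {S : Finset U} :
    pairs S ⊆ G.edgeFinset ↔ ∀ a ∈ S, ∀ b ∈ S, a ≠ b → G.Adj a b := by
  constructor
  · intro h a ha b hb hab
    simpa using h (mk_mem_pairs.2 ⟨ha, hb, hab⟩)
  · intro h e he
    induction e using Sym2.ind with
    | _ a b =>
      obtain ⟨ha, hb, hab⟩ := mk_mem_pairs.1 he
      simpa using h a ha b hb hab

/-- The members of `S` disapproved by `v`. -/
def missing (S : Finset U) (v : Finset (U ⊕ Unit)) : Finset U :=
  S.filter fun u => Sum.inl u ∉ v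

theorem missing_edgeVote_subset (S : Finset U) (a b : U) :
    missing S (edgeVote s(a, b)) ⊆ {a, b} := by
  intro u hu
  simpa [missing, inl_mem_edgeVote, or_iff_not_imp_left] using (Finset.mem_filter.1 hu).2

theorem card_missing_le_two {t : ℕ} (S : Finset U) {v : Finset (U ⊕ Unit)}
    (hv : v ∈ graphVotes G t) : (missing S v).card ≤ 2 := by
  rcases Multiset.mem_add.1 hv with h | h
  · rw [Multiset.eq_of_mem_replicate h]
    simp [missing]
  · obtain ⟨e, -, rfl⟩ := Multiset.mem_map.1 h
    induction e using Sym2.ind with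
    | _ a b => exact (Finset.card_le_card (missing_edgeVote_subset S a b)).trans Finset.card_le_two

theorem mem_pairs_of_two_le_card_missing {S : Finset U} {e : Sym2 U}
    (h : 2 ≤ (missing S (edgeVote e)).card) : e ∈ pairs S := by
  induction e using Sym2.ind with
  | _ a b =>
    have hsub := missing_edgeVote_subset S a b
    have heq := Finset.eq_of_subset_of_card_le hsub (Finset.card_le_two.trans h)
    have hS : ({a, b} : Finset U) ⊆ S := heq ▸ Finset.filter_subset _ _
    refine mk_mem_pairs.2 ⟨hS (by simp), hS (by simp), ?_⟩
    rintro rfl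
    rw [heq] at h
    simp at h

theorem countP_two_le_card_missing (t : ℕ) (S : Finset U) :
    (graphVotes G t).countP (fun v => 2 ≤ (missing S v).card) ≤
      (G.edgeFinset ∩ pairs S).card := by
  have h0 : (Multiset.replicate t (Finset.univ \ {(Sum.inr () : U ⊕ Unit)})).countP
      (fun v => 2 ≤ (missing S v).card) = 0 := by
    refine Multiset.countP_eq_zero.2 fun v hv => ?_
    rw [Multiset.eq_of_mem_replicate hv]
    simp [missing]
  rw [graphVotes, Multiset.countP_add, h0, zero_add, Multiset.countP_map]
  change (G.edgeFinset.filter fun e => 2 ≤ (missing S (edgeVote e)).card).card ≤ _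
  refine Finset.card_le_card fun e he => ?_
  rw [Finset.mem_filter] at he
  exact Finset.mem_inter.2 ⟨he.1, mem_pairs_of_two_le_card_missing he.2⟩

theorem choose_two_mul_two (k : ℕ) : k.choose 2 * 2 = k * (k - 1) := by
  rw [Nat.choose_two_right]
  exact Nat.div_mul_cancel (Nat.even_mul_pred_self k).two_dvd

/-- If few changed votes raise all members of `S` sufficiently, then `S` is a clique. -/
theorem pairs_subset_edgeFinset_of_gain {t : ℕ} {S : Finset U}
    {P : Multiset (Finset (U ⊕ Unit) × Finset (U ⊕ Unit))}
    (hP : graphVotes G t = P.map Prod.fst)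
    (hcount : P.countP (fun q => q.1 ≠ q.2) ≤ S.card.choose 2)
    (hgain : ∀ u ∈ S, S.card - 1 ≤
      (P.map fun q => if Sum.inl u ∉ q.1 ∧ Sum.inl u ∈ q.2 then 1 else 0).sum) :
    pairs S ⊆ G.edgeFinset := by
  have hsum : S.card * (S.card - 1) ≤
      (P.map fun q => (S.filter fun u => Sum.inl u ∉ q.1 ∧ Sum.inl u ∈ q.2).card).sum := by
    simp only [Finset.card_filter]
    rw [Multiset.sum_map_sum, ← smul_eq_mul]
    exact Finset.card_nsmul_le_sum _ _ _ hgain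
  have hle : (P.map fun q => (S.filter fun u => Sum.inl u ∉ q.1 ∧ Sum.inl u ∈ q.2).card).sum ≤
      (P.map fun q => (if q.1 ≠ q.2 then 1 else 0) +
        (if 2 ≤ (missing S q.1).card then 1 else 0)).sum := by
    refine Multiset.sum_map_le_sum_map _ _ fun q hq => ?_
    have h2 : (missing S q.1).card ≤ 2 :=
      card_missing_le_two G S (hP ▸ Multiset.mem_map_of_mem Prod.fst hq)
    by_cases hne : q.1 = q.2
    · simp [hne]
    · have h3 : (S.filter fun u => Sum.inl u ∉ q.1 ∧ Sum.inl u ∈ q.2).card ≤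
          (missing S q.1).card :=
        Finset.card_le_card (Finset.monotone_filter_right _ fun u _ h => h.1)
      rw [if_pos hne]
      split_ifs <;> omega
  rw [Multiset.sum_map_add, sum_map_ite_eq_countP, sum_map_ite_eq_countP] at hle
  have hedge := countP_two_le_card_missing G t S
  rw [hP, Multiset.countP_map, ← Multiset.countP_eq_card_filter] at hedge
  have hpairs := card_pairs S
  have htwo := choose_two_mul_two S.card
  rw [← Finset.eq_of_subset_of_card_le (Finset.inter_subset_right (s₁ := G.edgeFinset))
    (by omega : (pairs S).card ≤ (G.edgeFinset ∩ pairs S).card)]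
  exact Finset.inter_subset_left

/-- Approving everybody in the votes of the edges inside a clique. -/
def cliquePairs (t : ℕ) (S : Finset U) : Multiset (Finset (U ⊕ Unit) × Finset (U ⊕ Unit)) :=
  Multiset.replicate t
      (Finset.univ \ {(Sum.inr () : U ⊕ Unit)}, Finset.univ \ {(Sum.inr () : U ⊕ Unit)}) +
    G.edgeFinset.val.map fun e =>
      (edgeVote e, if e ∈ pairs S then Finset.univ else edgeVote e)

theorem card_univ_sdiff_edgeVote_le (e : Sym2 U) : (Finset.univ \ edgeVote e).card ≤ 2 := by
  induction e using Sym2.ind with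
  | _ a b =>
    have h : Finset.univ \ edgeVote s(a, b) ⊆ {Sum.inl a, Sum.inl b} := by
      rintro (u | x) hu
      · simpa [inl_mem_edgeVote, or_iff_not_imp_left] using hu
      · simp [inr_mem_edgeVote] at hu
    exact (Finset.card_le_card h).trans Finset.card_le_two

theorem voteAdditionChanges_cliquePairs {r : ℕ} (hr : 2 ≤ r) (t : ℕ) (S : Finset U) :
    VoteAdditionChanges Finset.univ (graphVotes G t) ((cliquePairs G t S).map Prod.snd)
      (S.card * (S.card - 1) / 2) r := by
  refine ⟨cliquePairs G t S, ?_, rfl, ?_, ?_⟩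
  · simp [cliquePairs, graphVotes]
  · intro q hq
    rcases Multiset.mem_add.1 hq with h | h
    · left
      rw [Multiset.eq_of_mem_replicate h]
    · obtain ⟨e, -, rfl⟩ := Multiset.mem_map.1 h
      by_cases he : e ∈ pairs S
      · right
        simpa [he] using (card_univ_sdiff_edgeVote_le e).trans hr
      · left
        simp [he]
  · rw [← Nat.choose_two_right, ← card_pairs, cliquePairs, Multiset.countP_add,
      Multiset.countP_map, Multiset.countP_eq_zero.2, zero_add]
    · change (G.edgeFinset.filter fun e =>
        edgeVote e ≠ if e ∈ pairs S then Finset.univ else edgeVote e).card ≤ _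
      refine Finset.card_le_card fun e he => ?_
      by_contra hn
      simp [hn] at he
    · intro q hq
      rw [Multiset.eq_of_mem_replicate hq]
      simp

theorem avScore_cliquePairs_inr (t : ℕ) (S : Finset U) :
    avScore ((cliquePairs G t S).map Prod.snd) (Sum.inr ()) = G.edgeFinset.card := by
  have h (e : Sym2 U) : Sum.inr () ∈ (if e ∈ pairs S then Finset.univ else edgeVote e) := by
    split_ifs <;> simp [inr_mem_edgeVote]
  simp [avScore, cliquePairs, h]

theorem le_avScore_cliquePairs_inl (hreg : G.IsRegularOfDegree d) (t : ℕ) {S : Finset U}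
    (hS : pairs S ⊆ G.edgeFinset) {u : U} (hu : u ∈ S) :
    t + G.edgeFinset.card + S.card ≤
      avScore ((cliquePairs G t S).map Prod.snd) (Sum.inl u) + d + 1 := by
  have hscore : avScore ((cliquePairs G t S).map Prod.snd) (Sum.inl u) =
      t + (G.edgeFinset.filter fun e => e ∈ pairs S ∨ u ∉ e).card := by
    have h (e : Sym2 U) : Sum.inl u ∈ (if e ∈ pairs S then Finset.univ else edgeVote e) ↔
        (e ∈ pairs S ∨ u ∉ e) := by
      split_ifs with he <;> simp [inl_mem_edgeVote, he]
    rw [Finset.card_filter]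
    simp [avScore, cliquePairs, h]
  have hsub : (G.edgeFinset.filter fun e => u ∉ e) ∪ (S.erase u).image (fun v => s(u, v)) ⊆
      G.edgeFinset.filter fun e => e ∈ pairs S ∨ u ∉ e := by
    intro e he
    rcases Finset.mem_union.1 he with h | h
    · rw [Finset.mem_filter] at h ⊢
      exact ⟨h.1, Or.inr h.2⟩
    · obtain ⟨v, hv, rfl⟩ := Finset.mem_image.1 h
      rw [Finset.mem_erase] at hv
      have hp : s(u, v) ∈ pairs S := mk_mem_pairs.2 ⟨hu, hv.2, hv.1.symm⟩
      exact Finset.mem_filter.2 ⟨hS hp, Or.inl hp⟩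
  have hdisj : Disjoint (G.edgeFinset.filter fun e => u ∉ e)
      ((S.erase u).image (fun v => s(u, v))) := by
    refine Finset.disjoint_left.2 fun e h1 h2 => ?_
    obtain ⟨v, -, rfl⟩ := Finset.mem_image.1 h2
    exact (Finset.mem_filter.1 h1).2 (Sym2.mem_mk_left u v)
  have hcard := Finset.card_le_card hsub
  rw [Finset.card_union_of_disjoint hdisj,
    Finset.card_image_of_injective _ (fun a b h => Sym2.congr_right.1 h)] at hcard
  have h1 := card_filter_notMem_edgeFinset G hreg u
  have h2 := Finset.card_erase_add_one hu
  omega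

end Graph

/-- destructive bribery by vote addition changes (at most `κ(κ−1)/2` votes,
each gaining at most `r ≥ 2` candidates) under AV in the election built from a `d`-regular
graph succeeds iff the graph has a clique of size `κ`. -/
theorem vac_av_clique {U : Type*} [Fintype U] [DecidableEq U]
    (G : SimpleGraph U) [DecidableRel G.Adj] (d κ r : ℕ)
    (hreg : G.IsRegularOfDegree d)
    (hκ : 2 < κ) (hdκ : κ < d) (hmd : d < G.edgeFinset.card) (hr : 2 ≤ r) :
    (∃ V' : Multiset (Finset (U ⊕ Unit)),
        VoteAdditionChanges Finset.univ
          (Multiset.replicate (d - κ + 2) (Finset.univ \ {(Sum.inr () : U ⊕ Unit)})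
            + G.edgeFinset.val.map (fun e =>
                Finset.univ \ ((Finset.univ.filter (· ∈ e)).image (Sum.inl : U → U ⊕ Unit))))
          V' (κ * (κ - 1) / 2) r ∧
        ∀ w, IsWinningCommittee Finset.univ κ (avCom V') w →
          (Sum.inr () : U ⊕ Unit) ∉ w)
    ↔ ∃ S : Finset U, S.card = κ ∧ ∀ a ∈ S, ∀ b ∈ S, a ≠ b → G.Adj a b := by
  change (∃ V', VoteAdditionChanges Finset.univ (graphVotes G (d - κ + 2)) V'
    (κ * (κ - 1) / 2) r ∧ _) ↔ _
  obtain ⟨e, he⟩ : G.edgeFinset.Nonempty := Finset.card_pos.1 (by omega)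
  have hκU : κ ≤ Fintype.card (U ⊕ Unit) := by
    have h := G.degree_lt_card_verts e.out.1
    rw [hreg] at h
    rw [Fintype.card_sum]
    omega
  simp only [forall_isWinningCommittee_notMem_iff hκU, ← pairs_subset_edgeFinset_iff]
  constructor
  · rintro ⟨V', ⟨P, hP, rfl, hsub, hcount⟩, w, hw, hlt⟩
    have hmono : ∀ q ∈ P, q.1 ⊆ q.2 := fun q hq =>
      (hsub q hq).elim (fun h => h.subset) (fun h => h.1)
    have hwS : (w.toLeft).card = κ := by
      have hr0 : w.toRight = ∅ := by
        refine Finset.eq_empty_of_forall_notMem fun x hx => ?_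
        exact lt_irrefl _ (hlt _ (Finset.mem_toRight.1 hx))
      have := Finset.card_toLeft_add_card_toRight (u := w)
      rw [hr0, Finset.card_empty] at this
      omega
    refine ⟨w.toLeft, hwS, pairs_subset_edgeFinset_of_gain G hP ?_ fun u hu => ?_⟩
    · rwa [hwS, Nat.choose_two_right]
    · have h1 := hlt _ (Finset.mem_toLeft.1 hu)
      rw [avScore_map_snd P hmono, avScore_map_snd P hmono, ← hP, avScore_graphVotes_inr] at h1
      have h2 := avScore_graphVotes_inl G hreg (d - κ + 2) u
      omega
  · rintro ⟨S, rfl, hS⟩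
    refine ⟨_, voteAdditionChanges_cliquePairs G hr _ S, S.map Function.Embedding.inl,
      Finset.card_map _, fun c hc => ?_⟩
    obtain ⟨u, hu, rfl⟩ := Finset.mem_map.1 hc
    have h := le_avScore_cliquePairs_inl G hreg (d - S.card + 2) hS hu
    rw [avScore_cliquePairs_inr]
    simp only [Function.Embedding.inl_apply]
    omega

end ApprovalBribery
end

section
/- Let (X,𝒞) be an RX3C instance with |X| = 3κ, where κ > 4 is even, and let r ≥ 1 be an integer. Consider the approval election with candidate set C = X ∪ {p}, p ∉ X, whose votes are: (3κ²/4 − 3κ) votes each equal to X, and for each H ∈ 𝒞 one vote equal to H. Then it is possible to select at most κ votes and replace each selected vote v by a vote v' with v ⊆ v' ⊆ C and |v'∖v| ≤ r, so that in the resulting election no candidate of X belongs to any winning 1-committee under SAV, if and only if 𝒞 contains an exact cover of X. -/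
namespace ApprovalBribery

variable {α : Type*} [DecidableEq α]

theorem savCom_singleton (V : Multiset (Finset α)) (c : α) :
    savCom V {c} = savScore V c := by
  unfold savCom savScore
  congr 1
  refine Multiset.map_congr rfl fun v _ => ?_
  by_cases h : c ∈ v <;> simp [h]

theorem savScore_add (V W : Multiset (Finset α)) (c : α) :
    savScore (V + W) c = savScore V c + savScore W c := by
  simp [savScore]

theorem savScore_replicate (n : ℕ) (v : Finset α) (c : α) :
    savScore (Multiset.replicate n v) c = n * if c ∈ v then ((v.card : ℚ))⁻¹ else 0 := by
  simp [savScore]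

theorem savScore_val (𝒟 : Finset (Finset α)) (c : α) :
    savScore 𝒟.val c = ∑ H ∈ 𝒟, if c ∈ H then ((H.card : ℚ))⁻¹ else 0 := rfl

/-- Every nonempty vote distributes exactly one point. -/
theorem sum_savScore (C : Finset α) (V : Multiset (Finset α))
    (hV : ∀ v ∈ V, v ⊆ C ∧ v.Nonempty) :
    ∑ c ∈ C, savScore V c = Multiset.card V := by
  induction V using Multiset.induction_on with
  | empty => simp [savScore]
  | cons v V ih =>
    have hv := hV v (Multiset.mem_cons_self v V)
    have hpos : (v.card : ℚ) ≠ 0 := by exact_mod_cast hv.2.card_ne_zero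
    have hone : ∑ c ∈ C, (if c ∈ v then ((v.card : ℚ))⁻¹ else 0) = 1 := by
      rw [Finset.sum_ite_mem, Finset.inter_eq_right.mpr hv.1]
      simp [hpos]
    have hrest := ih fun w hw => hV w (Multiset.mem_cons_of_mem hw)
    simp only [savScore, Multiset.map_cons, Multiset.sum_cons, Finset.sum_add_distrib] at hrest ⊢
    rw [hone, hrest, Multiset.card_cons]
    push_cast
    ring

theorem sum_card_filter_mem (X : Finset α) (𝒟 : Finset (Finset α)) (k : ℕ)
    (h𝒟 : ∀ H ∈ 𝒟, H ⊆ X ∧ H.card = k) :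
    ∑ x ∈ X, (𝒟.filter fun H => x ∈ H).card = 𝒟.card * k := by
  simp_rw [Finset.card_filter]
  rw [Finset.sum_comm, ← smul_eq_mul, ← Finset.sum_const]
  refine Finset.sum_congr rfl fun H hH => ?_
  rw [← Finset.card_filter, Finset.filter_mem_eq_inter, Finset.inter_eq_right.mpr (h𝒟 H hH).1,
    (h𝒟 H hH).2]

theorem savScore_val_of_mem {X : Finset α} {𝒞 : Finset (Finset α)} {κ : ℕ}
    (hR : IsRX3C X 𝒞 κ) {x : α} (hx : x ∈ X) : savScore 𝒞.val x = 1 := by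
  obtain ⟨-, -, h3, hdeg⟩ := hR
  rw [savScore_val, Finset.sum_congr rfl
    (g := fun H => if x ∈ H then (3 : ℚ)⁻¹ else 0) fun H hH => by rw [(h3 H hH).2]; norm_num,
    ← Finset.sum_filter, Finset.sum_const, hdeg x hx]
  norm_num

/-- No candidate of `X` lies in a winning singleton iff `p` strictly beats every one of them. -/
theorem forall_isWinningCommittee_one_iff (X : Finset α) (p : α) (hp : p ∉ X)
    (V : Multiset (Finset α)) :
    (∀ w, IsWinningCommittee (insert p X) 1 (savCom V) w → ∀ x ∈ X, x ∉ w) ↔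
      ∀ x ∈ X, savScore V x < savScore V p := by
  constructor
  · intro h x hx
    obtain ⟨c, hc, hmax⟩ := Finset.exists_max_image (insert p X) (savScore V)
      ⟨p, Finset.mem_insert_self p X⟩
    have hwin : ∀ d ∈ insert p X, (∀ e ∈ insert p X, savScore V e ≤ savScore V d) →
        IsWinningCommittee (insert p X) 1 (savCom V) {d} := by
      intro d hd hdm
      refine ⟨by simpa using hd, Finset.card_singleton d, fun w hw hw1 => ?_⟩
      obtain ⟨e, rfl⟩ := Finset.card_eq_one.mp hw1
      rw [savCom_singleton, savCom_singleton]
      exact hdm e (hw (Finset.mem_singleton_self e))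
    have hcp : c = p := by
      rcases Finset.mem_insert.mp hc with hc' | hc'
      · exact hc'
      · exact absurd (Finset.mem_singleton_self c) (h {c} (hwin c hc hmax) c hc')
    subst hcp
    by_contra hlt
    have hxm : IsWinningCommittee (insert c X) 1 (savCom V) {x} :=
      hwin x (Finset.mem_insert_of_mem hx) fun e he => (hmax e he).trans (not_lt.mp hlt)
    exact h {x} hxm x hx (Finset.mem_singleton_self x)
  · rintro h w ⟨-, hw1, hmax⟩ x hx hxw
    obtain ⟨c, rfl⟩ := Finset.card_eq_one.mp hw1
    obtain rfl := Finset.mem_singleton.mp hxw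
    have := hmax {p} (by simp) (Finset.card_singleton p)
    rw [savCom_singleton, savCom_singleton] at this
    exact absurd (h x hx) (not_lt.mpr this)

theorem card_eq_of_exactCover {X : Finset α} {𝒞 𝒟 : Finset (Finset α)} {κ : ℕ}
    (hR : IsRX3C X 𝒞 κ) (h𝒟 : 𝒟 ⊆ 𝒞)
    (hcov : ∀ x ∈ X, (𝒟.filter fun H => x ∈ H).card = 1) : 𝒟.card = κ := by
  have h := sum_card_filter_mem X 𝒟 3 fun H hH => hR.2.2.1 H (h𝒟 hH)
  rw [Finset.sum_congr rfl hcov] at h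
  have := hR.1
  simp at h
  omega

/-- A family of at most `κ` members of an RX3C instance that covers `X` covers it exactly. -/
theorem exactCover_of_covers {X : Finset α} {𝒞 𝒟 : Finset (Finset α)} {κ : ℕ}
    (hR : IsRX3C X 𝒞 κ) (h𝒟 : 𝒟 ⊆ 𝒞) (hcard : 𝒟.card ≤ κ)
    (hcov : ∀ x ∈ X, ∃ H ∈ 𝒟, x ∈ H) : HasExactCover X 𝒞 := by
  refine ⟨𝒟, h𝒟, ?_⟩
  have h := sum_card_filter_mem X 𝒟 3 fun H hH => hR.2.2.1 H (h𝒟 hH)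
  have hle : ∀ x ∈ X, 1 ≤ (𝒟.filter fun H => x ∈ H).card := fun x hx => by
    obtain ⟨H, hH, hxH⟩ := hcov x hx
    exact Finset.card_pos.mpr ⟨H, Finset.mem_filter.mpr ⟨hH, hxH⟩⟩
  have hXc := hR.1
  have heq : ∑ x ∈ X, 1 = ∑ x ∈ X, (𝒟.filter fun H => x ∈ H).card := by
    refine le_antisymm (Finset.sum_le_sum hle) ?_
    rw [h]
    simp
    omega
  exact fun x hx => ((Finset.sum_eq_sum_iff_of_le hle).mp heq x hx).symm

theorem exists_voteAdditionChanges_of_hasExactCover {X : Finset α} {𝒞 : Finset (Finset α)}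
    {κ n r : ℕ} (hr : 1 ≤ r) (hR : IsRX3C X 𝒞 κ) {p : α} (hp : p ∉ X)
    (hn : (n : ℚ) * ((X.card : ℚ))⁻¹ = κ / 4 - 1) (hE : HasExactCover X 𝒞) :
    ∃ V' : Multiset (Finset α),
      VoteAdditionChanges (insert p X) (Multiset.replicate n X + 𝒞.val) V' κ r ∧
      ∀ x ∈ X, savScore V' x < savScore V' p := by
  obtain ⟨𝒟, h𝒟, hcov⟩ := hE
  have hcard := card_eq_of_exactCover hR h𝒟 hcov
  have h3 := hR.2.2.1
  have hpH : ∀ H ∈ 𝒞, p ∉ H := fun H hH h => hp ((h3 H hH).1 h)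
  let g : Finset α → Finset α := fun H => if H ∈ 𝒟 then insert p H else H
  refine ⟨Multiset.replicate n X + 𝒞.val.map g,
    ⟨Multiset.replicate n (X, X) + 𝒞.val.map fun H => (H, g H), by simp, by simp, ?_, ?_⟩, ?_⟩
  · intro q hq
    rcases Multiset.mem_add.mp hq with hq | hq
    · left
      rw [Multiset.eq_of_mem_replicate hq]
    · obtain ⟨H, hH, rfl⟩ := Multiset.mem_map.mp hq
      by_cases hHD : H ∈ 𝒟
      · right
        simp only [g, hHD, if_true]
        refine ⟨Finset.subset_insert p H, Finset.insert_subset_insert p (h3 H hH).1, ?_⟩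
        have : insert p H \ H = {p} := by
          ext y
          have := hpH H hH
          simp only [Finset.mem_sdiff, Finset.mem_insert, Finset.mem_singleton]
          grind
        rw [this]
        simpa using hr
      · left
        simp [g, hHD]
  · rw [Multiset.countP_add, Multiset.countP_map, Multiset.countP_eq_zero.mpr, zero_add]
    · calc _ ≤ Multiset.card (𝒞.val.filter fun H => H ∈ 𝒟) := by
            refine Multiset.card_le_card (Multiset.monotone_filter_right _ fun H hH => ?_)
            by_contra hHD
            simp [g, hHD] at hH
        _ = (𝒞.filter fun H => H ∈ 𝒟).card := rfl
        _ ≤ κ := by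
            rw [← hcard]
            exact Finset.card_le_card fun H hH => (Finset.mem_filter.mp hH).2
    · intro q hq
      rw [Multiset.eq_of_mem_replicate hq]
      simp
  · have hmap : ∀ c, savScore (𝒞.val.map g) c =
        ∑ H ∈ 𝒞, if c ∈ g H then (((g H).card : ℚ))⁻¹ else 0 := fun c => by
      simp only [savScore, Multiset.map_map]
      rfl
    have hsc : ∀ f : Finset α → ℚ, ∑ H ∈ 𝒞, (if H ∈ 𝒟 then f H else 0) = ∑ H ∈ 𝒟, f H :=
      fun f => by rw [Finset.sum_ite_mem, Finset.inter_eq_right.mpr h𝒟]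
    have hP : savScore (𝒞.val.map g) p = κ / 4 := by
      rw [hmap, Finset.sum_congr rfl (g := fun H => if H ∈ 𝒟 then (4 : ℚ)⁻¹ else 0), hsc]
      · simp [hcard, div_eq_mul_inv]
      · intro H hH
        by_cases hHD : H ∈ 𝒟
        · simp [g, hHD, Finset.card_insert_of_notMem (hpH H hH), (h3 H hH).2]
        · simp [g, hHD, hpH H hH]
    intro x hx
    have hxp : x ≠ p := fun h => hp (h ▸ hx)
    have hXs : savScore (𝒞.val.map g) x = 1 - 1 / 12 := by
      have hone := savScore_val_of_mem hR hx
      rw [savScore_val] at hone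
      rw [hmap, Finset.sum_congr rfl
        (g := fun H => (if x ∈ H then ((H.card : ℚ))⁻¹ else 0) -
          if H ∈ 𝒟 then (if x ∈ H then (1 : ℚ) / 12 else 0) else 0),
        Finset.sum_sub_distrib, hsc, ← Finset.sum_filter (s := 𝒟), Finset.sum_const, hcov x hx, hone]
      · simp
      · intro H hH
        by_cases hHD : H ∈ 𝒟 <;> by_cases hxH : x ∈ H <;>
          simp [g, hHD, hxH, hxp, Finset.card_insert_of_notMem (hpH H hH), (h3 H hH).2]
        norm_num
    rw [savScore_add, savScore_add, savScore_replicate, savScore_replicate, if_pos hx,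
      if_neg hp, hXs, hP, hn]
    linarith

theorem hasExactCover_of_voteAdditionChanges {X : Finset α} {𝒞 : Finset (Finset α)}
    {κ n r : ℕ} (hκ : 1 < κ) (hR : IsRX3C X 𝒞 κ) {p : α} (hp : p ∉ X)
    (hn : (n : ℚ) = 3 * κ ^ 2 / 4 - 3 * κ) {V' : Multiset (Finset α)}
    (hV' : VoteAdditionChanges (insert p X) (Multiset.replicate n X + 𝒞.val) V' κ r)
    (hlt : ∀ x ∈ X, savScore V' x < savScore V' p) : HasExactCover X 𝒞 := by
  obtain ⟨P, hV, rfl, hP, hcount⟩ := hV'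
  have hXc := hR.1
  have h3 := hR.2.2.1
  have hκ' : (1 : ℚ) < κ := by exact_mod_cast hκ
  have hXq : (X.card : ℚ) = 3 * κ := by rw [hXc]; push_cast; ring
  have hfst : ∀ q ∈ P, q.1 = X ∨ q.1 ∈ 𝒞 := fun q hq => by
    have : q.1 ∈ Multiset.replicate n X + 𝒞.val := hV ▸ Multiset.mem_map_of_mem _ hq
    rcases Multiset.mem_add.mp this with h | h
    · exact Or.inl (Multiset.eq_of_mem_replicate h)
    · exact Or.inr h
  have hsub : ∀ q ∈ P, q.1 ⊆ X ∧ 3 ≤ q.1.card := fun q hq => by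
    rcases hfst q hq with h | h
    · rw [h]
      exact ⟨subset_rfl, by omega⟩
    · exact ⟨(h3 _ h).1, (h3 _ h).2.ge⟩
  have hsub' : ∀ q ∈ P, q.1 ⊆ q.2 ∧ q.2 ⊆ insert p X := fun q hq => by
    rcases hP q hq with h | h
    · exact ⟨h.subset, h ▸ (hsub q hq).1.trans (Finset.subset_insert p X)⟩
    · exact ⟨h.1, h.2.1⟩
  have hcardlt : ∀ q ∈ P, p ∈ q.2 → q.1.card + 1 ≤ q.2.card := fun q hq hpq =>
    Finset.card_lt_card ⟨(hsub' q hq).1, fun h => hp ((hsub q hq).1 (h hpq))⟩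
  have hscore : ∀ Q : Multiset (Finset α × Finset α), Q ≤ P →
      savScore (Q.map Prod.snd) p ≤ (Q.countP fun q => q.1 ≠ q.2) / 4 := by
    intro Q
    induction Q using Multiset.induction_on with
    | empty => simp [savScore]
    | cons q Q ih =>
      intro hQ
      have hq : q ∈ P := Multiset.mem_of_le hQ (Multiset.mem_cons_self q Q)
      have hQ' := ih ((Multiset.le_cons_self Q q).trans hQ)
      simp only [savScore, Multiset.map_cons, Multiset.sum_cons, Multiset.countP_cons] at hQ' ⊢
      by_cases hpq : p ∈ q.2
      · have hne : q.1 ≠ q.2 := fun h => hp ((hsub q hq).1 (h ▸ hpq))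
        have h4 : (4 : ℚ) ≤ q.2.card := by
          have h1 := hcardlt q hq hpq
          have h2 := (hsub q hq).2
          exact_mod_cast (by omega : 4 ≤ q.2.card)
        have hinv : ((q.2.card : ℚ))⁻¹ ≤ 4⁻¹ := inv_anti₀ (by norm_num) h4
        rw [if_pos hpq, if_pos hne]
        push_cast
        linarith
      · rw [if_neg hpq]
        have : (0 : ℚ) ≤ ((if q.1 ≠ q.2 then 1 else 0 : ℕ) : ℚ) := Nat.cast_nonneg _
        push_cast at this ⊢
        linarith
  have hcountq : ((P.countP fun q => q.1 ≠ q.2 : ℕ) : ℚ) ≤ κ := by exact_mod_cast hcount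
  have hpκ : savScore (P.map Prod.snd) p ≤ κ / 4 := by
    have := hscore P le_rfl
    linarith
  have htotal : (3 * κ ^ 2 / 4 : ℚ) < (3 * κ + 1) * savScore (P.map Prod.snd) p := by
    have hsum := sum_savScore (insert p X) (P.map Prod.snd) fun v hv => by
      obtain ⟨q, hq, rfl⟩ := Multiset.mem_map.mp hv
      refine ⟨(hsub' q hq).2, Finset.Nonempty.mono (hsub' q hq).1 (Finset.card_pos.mp ?_)⟩
      have := (hsub q hq).2
      omega
    have hcP : Multiset.card P = n + 3 * κ := by
      rw [← hR.2.1, ← Multiset.card_map Prod.fst P, ← hV]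
      simp
    have hne : X.Nonempty := Finset.card_pos.mp (by omega)
    have hlt' := Finset.sum_lt_sum_of_nonempty hne hlt
    rw [Finset.sum_insert hp, Multiset.card_map, hcP] at hsum
    rw [Finset.sum_const, nsmul_eq_mul, hXq] at hlt'
    push_cast at hsum
    linarith
  have hX : ∀ q ∈ P, q.1 ≠ q.2 → q.1 ≠ X := by
    intro q hq hne hqX
    obtain ⟨Q, rfl⟩ := Multiset.exists_cons_of_mem hq
    have hQ := hscore Q (Multiset.le_cons_self Q q)
    rw [Multiset.countP_cons, if_pos hne] at hcountq
    push_cast at hcountq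
    have hq2 : (if p ∈ q.2 then ((q.2.card : ℚ))⁻¹ else 0) ≤ (3 * κ + 1 : ℚ)⁻¹ := by
      split_ifs with hpq
      · refine inv_anti₀ (by positivity) ?_
        have := hcardlt q hq hpq
        rw [hqX, hXc] at this
        exact_mod_cast this
      · positivity
    have hle : savScore ((q ::ₘ Q).map Prod.snd) p ≤ (3 * κ + 1 : ℚ)⁻¹ + (κ - 1) / 4 := by
      simp only [savScore, Multiset.map_cons, Multiset.sum_cons] at hQ ⊢
      linarith
    have hmul := mul_le_mul_of_nonneg_left hle (by positivity : (0 : ℚ) ≤ 3 * κ + 1)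
    rw [mul_add, mul_inv_cancel₀ (by positivity)] at hmul
    nlinarith
  refine exactCover_of_covers hR (𝒟 := ((P.filter fun q => q.1 ≠ q.2).map Prod.fst).toFinset)
    ?_ ?_ ?_
  · intro H hH
    obtain ⟨q, hq, rfl⟩ := Multiset.mem_map.mp (Multiset.mem_toFinset.mp hH)
    obtain ⟨hq, hne⟩ := Multiset.mem_filter.mp hq
    exact (hfst q hq).resolve_left (hX q hq hne)
  · refine (Multiset.toFinset_card_le _).trans ?_
    rwa [Multiset.card_map, ← Multiset.countP_eq_card_filter]
  · intro x hx
    by_contra! hno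
    have hunch : ∀ q ∈ P, x ∈ q.1 → q.1 = q.2 := fun q hq hxq => by
      by_contra hne
      exact hno q.1 (Multiset.mem_toFinset.mpr (Multiset.mem_map_of_mem _
        (Multiset.mem_filter.mpr ⟨hq, hne⟩))) hxq
    have hge : savScore (P.map Prod.fst) x ≤ savScore (P.map Prod.snd) x := by
      simp only [savScore, Multiset.map_map]
      refine Multiset.sum_map_le_sum_map _ _ fun q hq => ?_
      by_cases hxq : x ∈ q.1
      · simp only [Function.comp, hunch q hq hxq]
        exact le_rfl
      · simp only [Function.comp, if_neg hxq]
        split_ifs <;> positivity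
    have hinit : savScore (P.map Prod.fst) x = κ / 4 := by
      rw [← hV, savScore_add, savScore_replicate, if_pos hx, savScore_val_of_mem hR hx, hXq, hn]
      field_simp
      ring
    have := hlt x hx
    linarith

/-- destructive bribery by vote addition changes (at most `κ` votes, each
gaining at most `r ≥ 1` candidates) under SAV in the election built from an RX3C instance
succeeds iff the instance has an exact cover. -/
theorem vac_sav_rx3c
    (X : Finset α) (𝒞 : Finset (Finset α)) (κ r : ℕ)
    (hκ : 4 < κ) (hκeven : Even κ) (hr : 1 ≤ r) (hR : IsRX3C X 𝒞 κ)
    (p : α) (hp : p ∉ X) :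
    (∃ V' : Multiset (Finset α),
        VoteAdditionChanges (insert p X)
          (Multiset.replicate (3 * κ ^ 2 / 4 - 3 * κ) X + 𝒞.val) V' κ r ∧
        ∀ w, IsWinningCommittee (insert p X) 1 (savCom V') w → ∀ x ∈ X, x ∉ w)
    ↔ HasExactCover X 𝒞 := by
  have hn : ((3 * κ ^ 2 / 4 - 3 * κ : ℕ) : ℚ) = 3 * κ ^ 2 / 4 - 3 * κ := by
    obtain ⟨m, rfl⟩ := hκeven
    have h1 : 3 * (m + m) ^ 2 / 4 = 3 * m ^ 2 :=
      Nat.div_eq_of_eq_mul_left (by norm_num) (by ring)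
    rw [h1, Nat.cast_sub (by nlinarith)]
    push_cast
    ring
  have hκ0 : (κ : ℚ) ≠ 0 := by exact_mod_cast (by omega : κ ≠ 0)
  simp only [forall_isWinningCommittee_one_iff X p hp]
  constructor
  · rintro ⟨V', hV', hlt⟩
    exact hasExactCover_of_voteAdditionChanges (by omega) hR hp hn hV' hlt
  · refine exists_voteAdditionChanges_of_hasExactCover hr hR hp ?_
    rw [hn, hR.1]
    push_cast
    field_simp

end ApprovalBribery
end

section
/- Let (X,𝒞) be an RX3C instance with |X| = 3κ, κ ≥ 1, and let r ≥ 3 be an integer. Consider the approval election with candidate set C = X ∪ {p}, p ∉ X, whose votes are: three votes each equal to {p}, and for each H ∈ 𝒞 one vote equal to H. Then it is possible to select at most κ votes and replace each selected vote v by a vote v' with v' ⊆ v and |v∖v'| ≤ r, so that in the resulting election no candidate of X belongs to any winning 1-committee under AV, if and only if 𝒞 contains an exact cover of X. -/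
namespace ApprovalBribery

variable {α : Type*} [DecidableEq α]

/-- Double counting of incidences between `X` and a family of 3-element subsets of `X`. -/
lemma sum_card_filter_mem_eq (X : Finset α) (𝒟 : Finset (Finset α))
    (h : ∀ H ∈ 𝒟, H ⊆ X ∧ H.card = 3) :
    ∑ x ∈ X, (𝒟.filter fun H => x ∈ H).card = 3 * 𝒟.card := by
  have h1 := Finset.sum_card_bipartiteAbove_eq_sum_card_bipartiteBelow
    (s := X) (t := 𝒟) (fun x H => x ∈ H)
  unfold Finset.bipartiteAbove Finset.bipartiteBelow at h1
  rw [h1, Finset.sum_congr rfl (g := fun _ => 3)]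
  · simp [mul_comm]
  · intro H hH
    rw [Finset.filter_mem_eq_inter, Finset.inter_eq_right.mpr (h H hH).1, (h H hH).2]

lemma avCom_singleton (V : Multiset (Finset α)) (c : α) :
    avCom V {c} = V.countP (fun v => c ∈ v) := by
  unfold avCom
  induction V using Multiset.induction_on with
  | empty => simp
  | cons v V ih =>
    rw [Multiset.map_cons, Multiset.sum_cons, ih, Multiset.countP_cons, add_comm]
    by_cases h : c ∈ v <;> simp [h]

lemma countP_replicate {β : Type*} (q : β → Prop) [DecidablePred q] (n : ℕ) (b : β) :
    (Multiset.replicate n b).countP q = if q b then n else 0 := by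
  induction n with
  | zero => simp
  | succ n ih =>
    rw [Multiset.replicate_succ, Multiset.countP_cons, ih]
    split_ifs <;> rfl

lemma countP_val_eq_card_filter {β : Type*} (s : Finset β) (q : β → Prop)
    [DecidablePred q] : s.val.countP q = (s.filter q).card := by
  rw [Multiset.countP_eq_card_filter]
  rfl

lemma countP_snd_le_countP_fst {β : Type*} (P : Multiset (β × β)) (f : β → Prop)
    [DecidablePred f] (h : ∀ q ∈ P, f q.2 → f q.1) :
    (P.map Prod.snd).countP f ≤ (P.map Prod.fst).countP f := by
  rw [Multiset.countP_map, Multiset.countP_map, ← Multiset.countP_eq_card_filter,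
    ← Multiset.countP_eq_card_filter]
  induction P using Multiset.induction_on with
  | empty => simp
  | cons q P ih =>
    have h1 := ih fun q' hq' => h q' (Multiset.mem_cons_of_mem hq')
    have h2 := h q (Multiset.mem_cons_self q P)
    rw [Multiset.countP_cons, Multiset.countP_cons]
    split_ifs <;> first | omega | tauto

lemma countP_fst_le_countP_snd {β : Type*} (P : Multiset (β × β)) (f : β → Prop)
    [DecidablePred f] (h : ∀ q ∈ P, f q.1 → f q.2) :
    (P.map Prod.fst).countP f ≤ (P.map Prod.snd).countP f := by
  have h1 := countP_snd_le_countP_fst (P.map Prod.swap) f (by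
    rintro q hq
    obtain ⟨q', hq', rfl⟩ := Multiset.mem_map.mp hq
    exact h q' hq')
  simpa [Multiset.map_map, Function.comp_def] using h1

lemma avCom_initial_candidate {X : Finset α} {𝒞 : Finset (Finset α)} {κ : ℕ}
    (hR : IsRX3C X 𝒞 κ) {p : α} (hp : p ∉ X) {c : α} (hc : c ∈ insert p X) :
    avCom (Multiset.replicate 3 {p} + 𝒞.val) {c} = 3 := by
  obtain ⟨-, -, h3, h4⟩ := hR
  rw [avCom_singleton, Multiset.countP_add, countP_val_eq_card_filter]
  rcases Finset.mem_insert.mp hc with rfl | hc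
  · rw [Finset.filter_false_of_mem fun H hH hcH => hp ((h3 H hH).1 hcH)]
    rw [countP_replicate, if_pos (Finset.mem_singleton_self c), Finset.card_empty]
  · have hcp : c ≠ p := fun h => hp (h ▸ hc)
    rw [h4 c hc]
    rw [countP_replicate, if_neg (by simpa using hcp)]

/-- A family of at most `κ` triples covering a set of size `3κ` is an exact cover. -/
lemma card_filter_eq_one_of_cover {X : Finset α} {𝒟 : Finset (Finset α)} {κ : ℕ}
    (hX : X.card = 3 * κ) (h3 : ∀ H ∈ 𝒟, H ⊆ X ∧ H.card = 3) (hcard : 𝒟.card ≤ κ)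
    (hcov : ∀ x ∈ X, ∃ H ∈ 𝒟, x ∈ H) :
    ∀ x ∈ X, (𝒟.filter fun H => x ∈ H).card = 1 := by
  have hge : ∀ x ∈ X, 1 ≤ (𝒟.filter fun H => x ∈ H).card := by
    intro x hx
    obtain ⟨H, hH, hxH⟩ := hcov x hx
    exact Finset.card_pos.mpr ⟨H, Finset.mem_filter.mpr ⟨hH, hxH⟩⟩
  have hsum := sum_card_filter_mem_eq X 𝒟 h3
  have hle : ∑ _x ∈ X, 1 ≤ ∑ x ∈ X, (𝒟.filter fun H => x ∈ H).card :=
    Finset.sum_le_sum hge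
  have heq : ∑ _x ∈ X, 1 = ∑ x ∈ X, (𝒟.filter fun H => x ∈ H).card := by
    refine le_antisymm hle ?_
    rw [hsum, Finset.sum_const, smul_eq_mul, mul_one]
    omega
  intro x hx
  exact ((Finset.sum_eq_sum_iff_of_le hge).mp heq x hx).symm

lemma hasExactCover_of_voteDeletionChanges {X : Finset α} {𝒞 : Finset (Finset α)} {κ r : ℕ}
    (hR : IsRX3C X 𝒞 κ) {p : α} (hp : p ∉ X) {V' : Multiset (Finset α)}
    (hV : VoteDeletionChanges (Multiset.replicate 3 {p} + 𝒞.val) V' κ r)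
    (hwin : ∀ w, IsWinningCommittee (insert p X) 1 (avCom V') w → ∀ x ∈ X, x ∉ w) :
    HasExactCover X 𝒞 := by
  obtain ⟨P, hP1, rfl, hP, hcount⟩ := hV
  have hinit := fun c => avCom_initial_candidate hR hp (c := c)
  obtain ⟨hX, -, h3, -⟩ := hR
  have hsub : ∀ q ∈ P, q.2 ⊆ q.1 := fun q hq =>
    (hP q hq).elim (fun h => h ▸ Finset.Subset.refl _) And.left
  rw [hP1] at hinit
  have hloss : ∀ x ∈ X, ∃ q ∈ P, x ∈ q.1 ∧ x ∉ q.2 := by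
    intro x hx
    by_contra! hno
    refine hwin {x} ⟨by simp [hx], by simp, ?_⟩ x hx (by simp)
    intro w hw hw1
    obtain ⟨c, rfl⟩ := Finset.card_eq_one.mp hw1
    calc avCom (P.map Prod.snd) {c} ≤ avCom (P.map Prod.fst) {c} := by
          rw [avCom_singleton, avCom_singleton]
          exact countP_snd_le_countP_fst P _ fun q hq h => hsub q hq h
      _ = avCom (P.map Prod.fst) {x} := by
          rw [hinit c (by simpa using hw), hinit x (by simp [hx])]
      _ ≤ avCom (P.map Prod.snd) {x} := by
          rw [avCom_singleton, avCom_singleton]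
          exact countP_fst_le_countP_snd P _ hno
  set 𝒟 := 𝒞 ∩ ((P.filter fun q => q.1 ≠ q.2).map Prod.fst).toFinset
  refine ⟨𝒟, Finset.inter_subset_left, card_filter_eq_one_of_cover hX
    (fun H hH => h3 H (Finset.inter_subset_left hH)) ?_ ?_⟩
  · calc 𝒟.card ≤ ((P.filter fun q => q.1 ≠ q.2).map Prod.fst).toFinset.card :=
          Finset.card_le_card Finset.inter_subset_right
      _ ≤ ((P.filter fun q => q.1 ≠ q.2).map Prod.fst).card := Multiset.toFinset_card_le _
      _ ≤ κ := by rwa [Multiset.card_map, ← Multiset.countP_eq_card_filter]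
  · intro x hx
    obtain ⟨q, hq, hx1, hx2⟩ := hloss x hx
    have hmem : q.1 ∈ Multiset.replicate 3 {p} + 𝒞.val := hP1 ▸ Multiset.mem_map_of_mem _ hq
    refine ⟨q.1, Finset.mem_inter.mpr ⟨?_, ?_⟩, hx1⟩
    · rcases Multiset.mem_add.mp hmem with h | h
      · rw [Multiset.eq_of_mem_replicate h, Finset.mem_singleton] at hx1
        exact absurd (hx1 ▸ hx) hp
      · exact h
    · rw [Multiset.mem_toFinset]
      exact Multiset.mem_map_of_mem _
        (Multiset.mem_filter.mpr ⟨hq, fun h => hx2 (h ▸ hx1)⟩)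

lemma exists_voteDeletionChanges_of_hasExactCover {X : Finset α} {𝒞 : Finset (Finset α)}
    {κ r : ℕ} (hr : 3 ≤ r) (hR : IsRX3C X 𝒞 κ) {p : α} (hp : p ∉ X)
    (hcover : HasExactCover X 𝒞) :
    ∃ V' : Multiset (Finset α),
      VoteDeletionChanges (Multiset.replicate 3 {p} + 𝒞.val) V' κ r ∧
      ∀ w, IsWinningCommittee (insert p X) 1 (avCom V') w → ∀ x ∈ X, x ∉ w := by
  obtain ⟨hX, -, h3, h4⟩ := hR
  obtain ⟨𝒞', hsub, hex⟩ := hcover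
  have hcard : 𝒞'.card = κ := by
    have h := sum_card_filter_mem_eq X 𝒞' fun H hH => h3 H (hsub hH)
    rw [Finset.sum_congr rfl hex, Finset.sum_const, smul_eq_mul, hX] at h
    omega
  let g : Finset α → Finset α := fun H => if H ∈ 𝒞' then ∅ else H
  refine ⟨Multiset.replicate 3 {p} + 𝒞.val.map g,
    ⟨Multiset.replicate 3 ({p}, {p}) + 𝒞.val.map fun H => (H, g H), ?_, ?_, ?_, ?_⟩, ?_⟩
  · simp [Multiset.map_map]
  · simp [Multiset.map_map]
  · intro q hq
    rcases Multiset.mem_add.mp hq with h | h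
    · left
      rw [Multiset.eq_of_mem_replicate h]
    · right
      obtain ⟨H, hH, rfl⟩ := Multiset.mem_map.mp h
      refine ⟨by dsimp only [g]; split_ifs <;> simp, ?_⟩
      exact (Finset.card_le_card Finset.sdiff_subset).trans ((h3 H hH).2.trans_le hr)
  · rw [Multiset.countP_add, Multiset.countP_map, ← Multiset.countP_eq_card_filter,
      countP_val_eq_card_filter, countP_replicate, ← hcard]
    simp only [ne_eq, not_true_eq_false, if_false, zero_add]
    refine Finset.card_le_card fun H hH => ?_
    by_contra hn
    simp [g, hn] at hH
  · rintro w ⟨-, hw1, hmax⟩ x hx hxw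
    obtain ⟨c, rfl⟩ := Finset.card_eq_one.mp hw1
    obtain rfl := Finset.mem_singleton.mp hxw
    have hxp : x ≠ p := fun h => hp (h ▸ hx)
    have h := hmax {p} (by simp) (by simp)
    obtain ⟨K, hK⟩ := Finset.card_pos.mp ((hex x hx).symm ▸ Nat.one_pos)
    obtain ⟨hK, hxK⟩ := Finset.mem_filter.mp hK
    have hlt : (𝒞.filter fun H => x ∈ g H).card < 3 := by
      rw [← h4 x hx]
      refine Finset.card_lt_card (Finset.ssubset_iff_of_subset ?_ |>.mpr
        ⟨K, Finset.mem_filter.mpr ⟨hsub hK, hxK⟩, by simp [g, hK]⟩)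
      refine Finset.monotone_filter_right _ fun H _ hH => ?_
      by_contra hn
      dsimp only [g] at hH
      split_ifs at hH <;> simp_all
    rw [avCom_singleton, avCom_singleton, Multiset.countP_add, Multiset.countP_add,
      countP_replicate, countP_replicate,
      if_pos (Finset.mem_singleton_self p), if_neg (by simpa using hxp), Multiset.countP_map
      (p := fun v => x ∈ v), ← Multiset.countP_eq_card_filter, countP_val_eq_card_filter] at h
    omega

/-- destructive bribery by vote deletion changes (at most `κ` votes, each
losing at most `r ≥ 3` candidates) under AV in the election built from an RX3C instance
succeeds iff the instance has an exact cover. -/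
theorem vdc_av_rx3c
    (X : Finset α) (𝒞 : Finset (Finset α)) (κ r : ℕ)
    (hκ : 1 ≤ κ) (hr : 3 ≤ r) (hR : IsRX3C X 𝒞 κ)
    (p : α) (hp : p ∉ X) :
    (∃ V' : Multiset (Finset α),
        VoteDeletionChanges (Multiset.replicate 3 {p} + 𝒞.val) V' κ r ∧
        ∀ w, IsWinningCommittee (insert p X) 1 (avCom V') w → ∀ x ∈ X, x ∉ w)
    ↔ HasExactCover X 𝒞 := by
  exact ⟨fun ⟨_, hV, hwin⟩ => hasExactCover_of_voteDeletionChanges hR hp hV hwin,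
    exists_voteDeletionChanges_of_hasExactCover hr hR hp⟩

end ApprovalBribery
end

section
/- Let (C,V) be an approval election, let J ⊆ C be a nonempty set of distinguished candidates, let k be a positive integer with k ≤ |C∖J|, and let ℓ be a nonnegative integer. Let s be the k-th largest AV score among the candidates of C∖J (counted with multiplicity), and let J' = {c ∈ J : AV(c) ≥ s}. Then it is possible to select at most ℓ votes and delete exactly one candidate from each selected vote, so that in the resulting election no candidate of J belongs to any winning k-committee under AV, if and only if Σ_{c∈J'} (AV(c) − s + 1) ≤ ℓ and there exists a family (S_c)_{c∈J'} of pairwise disjoint sets of votes such that for each c ∈ J' every vote in S_c contains c and |S_c| = AV(c) − s + 1. -/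
namespace ApprovalBribery

variable {α : Type*} [DecidableEq α]

theorem avScore_eq_countP (V : Multiset (Finset α)) (c : α) :
    avScore V c = V.countP (fun v => c ∈ v) := by
  unfold avScore
  induction V using Multiset.induction_on with
  | empty => simp
  | cons v V ih => rw [Multiset.map_cons, Multiset.sum_cons, ih, Multiset.countP_cons, add_comm]

/-- The score of a candidate drops by the number of pairs in which the candidate is deleted. -/
theorem avScore_map_fst_eq_add (P : Multiset (Finset α × Finset α))
    (hP : ∀ q ∈ P, q.2 ⊆ q.1) (c : α) :
    avScore (P.map Prod.fst) c =
      avScore (P.map Prod.snd) c + P.countP (fun q => c ∈ q.1 \ q.2) := by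
  simp only [avScore_eq_countP]
  induction P using Multiset.induction_on with
  | empty => simp
  | cons q P ih =>
    have hq : c ∈ q.2 → c ∈ q.1 := fun h => hP q (Multiset.mem_cons_self q P) h
    have := ih fun p hp => hP p (Multiset.mem_cons_of_mem hp)
    simp only [Multiset.map_cons, Multiset.countP_cons, this, Finset.mem_sdiff]
    by_cases h1 : c ∈ q.1 <;> by_cases h2 : c ∈ q.2 <;> simp_all <;> lia

/-- Exchanging one member of a committee changes the score by the difference of the two
candidates. -/
theorem avCom_insert_erase_add (V : Multiset (Finset α)) {w : Finset α} {c d : α}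
    (hd : d ∈ w) (hc : c ∉ w) :
    avCom V (insert c (w.erase d)) + avScore V d = avCom V w + avScore V c := by
  have hc' : c ∉ w.erase d := fun h => hc (Finset.mem_of_mem_erase h)
  rw [avCom_eq_sum_avScore, avCom_eq_sum_avScore, Finset.sum_insert hc',
    ← Finset.add_sum_erase w _ hd]
  ring

/-- A winning committee cannot be improved by exchanging one of its members. -/
theorem IsWinningCommittee.avScore_le {C : Finset α} {k : ℕ} {V : Multiset (Finset α)}
    {w : Finset α} (hw : IsWinningCommittee C k (avCom V) w) {c d : α} (hd : d ∈ w)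
    (hc : c ∉ w) (hcC : c ∈ C) : avScore V c ≤ avScore V d := by
  obtain ⟨hwC, hwk, hmax⟩ := hw
  have hc' : c ∉ w.erase d := fun h => hc (Finset.mem_of_mem_erase h)
  have hle := hmax (insert c (w.erase d))
    (Finset.insert_subset hcC ((Finset.erase_subset d w).trans hwC))
    (by rw [Finset.card_insert_of_notMem hc', Finset.card_erase_add_one hd, hwk])
  have := avCom_insert_erase_add V hd hc
  omega

/-- If no candidate of `J` is in a winning committee, then every candidate of `J` is beaten
by at least `k` candidates outside `J`. -/
theorem le_card_filter_avScore_lt {C J : Finset α} (hJC : J ⊆ C) {k : ℕ} (hk : k ≤ C.card)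
    {V : Multiset (Finset α)}
    (h : ∀ w, IsWinningCommittee C k (avCom V) w → ∀ c ∈ J, c ∉ w) {c : α} (hc : c ∈ J) :
    k ≤ ((C \ J).filter fun d => avScore V c < avScore V d).card := by
  obtain ⟨w, hw⟩ := exists_isWinningCommittee hk (avCom V)
  rw [← hw.2.1]
  refine Finset.card_le_card fun d hd => ?_
  rw [Finset.mem_filter, Finset.mem_sdiff]
  refine ⟨⟨hw.1 hd, fun hdJ => h w hw d hdJ hd⟩, ?_⟩
  by_contra! hle
  have hcw := h w hw c hc
  have hc' : c ∉ w.erase d := fun h => hcw (Finset.mem_of_mem_erase h)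
  have hsub : insert c (w.erase d) ⊆ C :=
    Finset.insert_subset (hJC hc) ((Finset.erase_subset d w).trans hw.1)
  refine h (insert c (w.erase d)) ⟨hsub, ?_, fun w' h1 h2 => ?_⟩ c hc (Finset.mem_insert_self _ _)
  · rw [Finset.card_insert_of_notMem hc', Finset.card_erase_add_one hd, hw.2.1]
  · have := hw.2.2 w' h1 h2
    have := avCom_insert_erase_add V hd hcw
    omega

/-- Restricting a multiset to pairwise exclusive predicates yields a submultiset. -/
theorem sum_filter_le_filter {ι β : Type*} [DecidableEq β] (A : Finset ι) (P : Multiset β)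
    (p : ι → β → Prop) [∀ i, DecidablePred (p i)] (r : β → Prop) [DecidablePred r]
    (hr : ∀ b ∈ P, ∀ i ∈ A, p i b → r b)
    (hp : ∀ b ∈ P, ∀ i ∈ A, ∀ j ∈ A, p i b → p j b → i = j) :
    ∑ i ∈ A, P.filter (p i) ≤ P.filter r := by
  rw [Multiset.le_iff_count]
  intro b
  rw [Multiset.count_sum']
  by_cases h : b ∈ P ∧ ∃ i ∈ A, p i b
  · obtain ⟨hb, i, hi, hpi⟩ := h
    rw [Finset.sum_eq_single_of_mem i hi, Multiset.count_filter_of_pos hpi,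
      Multiset.count_filter_of_pos (hr b hb i hi hpi)]
    intro j hj hji
    exact Multiset.count_filter_of_neg fun hpj => hji (hp b hb j hj i hi hpj hpi)
  · rw [Finset.sum_eq_zero]
    · exact Nat.zero_le _
    · intro i hi
      rw [Multiset.count_eq_zero, Multiset.mem_filter]
      exact fun hb => h ⟨hb.1, i, hi, hb.2⟩

theorem exists_le_card_eq {β : Type*} {P : Multiset β} {n : ℕ} (h : n ≤ Multiset.card P) :
    ∃ T ≤ P, Multiset.card T = n := by
  induction P using Quotient.inductionOn with
  | h l => exact ⟨l.take n, (List.take_sublist n l).subperm, List.length_take_of_le h⟩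

/-- Deletions lowering the score of each `c ∈ A` by at least `n c` contain disjoint families of
`n c` votes approving `c`. -/
theorem VoteDeletionChanges.exists_deletions {V V' : Multiset (Finset α)} {ℓ : ℕ}
    (h : VoteDeletionChanges V V' ℓ 1) (A : Finset α) (n : α → ℕ)
    (hn : ∀ c ∈ A, avScore V' c + n c ≤ avScore V c) :
    ∑ c ∈ A, n c ≤ ℓ ∧ ∃ S : α → Multiset (Finset α), ∑ c ∈ A, S c ≤ V ∧
      ∀ c ∈ A, (∀ v ∈ S c, c ∈ v) ∧ Multiset.card (S c) = n c := by
  obtain ⟨P, rfl, rfl, hP, hcount⟩ := h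
  have hsub : ∀ q ∈ P, q.2 ⊆ q.1 := fun q hq =>
    (hP q hq).elim (fun h => h ▸ Finset.Subset.refl _) (fun h => h.1)
  have hcard : ∀ q ∈ P, (q.1 \ q.2).card ≤ 1 := fun q hq =>
    (hP q hq).elim (fun h => by simp [h]) (fun h => h.2)
  have key : ∀ c, ∃ T ≤ P.filter (fun q => c ∈ q.1 \ q.2),
      c ∈ A → Multiset.card T = n c := by
    intro c
    by_cases hc : c ∈ A
    · have h1 := hn c hc
      rw [avScore_map_fst_eq_add P hsub c, Multiset.countP_eq_card_filter] at h1
      obtain ⟨T, hT, hTc⟩ := exists_le_card_eq (Nat.le_of_add_le_add_left h1)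
      exact ⟨T, hT, fun _ => hTc⟩
    · exact ⟨0, Multiset.zero_le _, fun h => absurd h hc⟩
  choose T hT hTn using key
  have hle : ∑ c ∈ A, T c ≤ P.filter (fun q => q.1 ≠ q.2) := by
    refine (Finset.sum_le_sum fun c _ => hT c).trans (sum_filter_le_filter A P _ _ ?_ ?_)
    · rintro q - c - hc heq
      simp [heq] at hc
    · intro q hq c _ d _ hc hd
      exact Finset.card_le_one.1 (hcard q hq) c hc d hd
  refine ⟨?_, fun c => (T c).map Prod.fst, ?_, fun c hc => ⟨fun v hv => ?_, ?_⟩⟩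
  · calc ∑ c ∈ A, n c = Multiset.card (∑ c ∈ A, T c) := by
          rw [Multiset.card_sum]
          exact Finset.sum_congr rfl fun c hc => (hTn c hc).symm
      _ ≤ _ := Multiset.card_le_card hle
      _ ≤ ℓ := by rwa [← Multiset.countP_eq_card_filter]
  · calc ∑ c ∈ A, (T c).map Prod.fst = (∑ c ∈ A, T c).map Prod.fst :=
          (map_sum (Multiset.mapAddMonoidHom Prod.fst) T A).symm
      _ ≤ P.map Prod.fst := Multiset.map_le_map (hle.trans (Multiset.filter_le _ _))
  · obtain ⟨q, hq, rfl⟩ := Multiset.mem_map.1 hv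
    exact (Finset.mem_sdiff.1 (Multiset.mem_filter.1 (Multiset.mem_of_le (hT c) hq)).2).1
  · rw [Multiset.card_map, hTn c hc]

/-- Deleting each `c ∈ A` from the votes in `S c` lowers its score by the size of `S c`. -/
theorem exists_voteDeletionChanges {V : Multiset (Finset α)} (A : Finset α)
    (S : α → Multiset (Finset α)) (hS : ∑ c ∈ A, S c ≤ V)
    (hmem : ∀ c ∈ A, ∀ v ∈ S c, c ∈ v) {ℓ : ℕ}
    (hℓ : ∑ c ∈ A, Multiset.card (S c) ≤ ℓ) :
    ∃ V', VoteDeletionChanges V V' ℓ 1 ∧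
      ∀ c, avScore V c = avScore V' c + if c ∈ A then Multiset.card (S c) else 0 := by
  set P : Multiset (Finset α × Finset α) :=
    (V - ∑ c ∈ A, S c).map (fun v => (v, v)) +
      ∑ c ∈ A, (S c).map (fun v => (v, v.erase c)) with hPdef
  have hfst : P.map Prod.fst = V := by
    have : (∑ c ∈ A, (S c).map (fun v => (v, v.erase c))).map Prod.fst = ∑ c ∈ A, S c := by
      rw [← Multiset.coe_mapAddMonoidHom, map_sum]
      simp
    rw [hPdef, Multiset.map_add, this]
    simpa using tsub_add_cancel_of_le hS
  have hcountP : ∀ (p : Finset α × Finset α → Prop) [DecidablePred p], (∀ v, ¬ p (v, v)) →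
      P.countP p = ∑ a ∈ A, (S a).countP (fun v => p (v, v.erase a)) := by
    intro p _ hp
    rw [hPdef, Multiset.countP_add, ← Multiset.coe_countPAddMonoidHom, map_sum]
    simp only [Multiset.coe_countPAddMonoidHom, Multiset.countP_map, hp]
    simp [Multiset.countP_eq_card_filter]
  have hP : ∀ q ∈ P, q.1 = q.2 ∨ (q.2 ⊆ q.1 ∧ (q.1 \ q.2).card ≤ 1) := by
    intro q hq
    rw [hPdef, Multiset.mem_add, Multiset.mem_sum] at hq
    rcases hq with hq | ⟨c, -, hq⟩
    · obtain ⟨v, -, rfl⟩ := Multiset.mem_map.1 hq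
      exact Or.inl rfl
    · obtain ⟨v, -, rfl⟩ := Multiset.mem_map.1 hq
      refine Or.inr ⟨Finset.erase_subset c v, Finset.card_le_one.2 fun x hx y hy => ?_⟩
      simp only [Finset.mem_sdiff, Finset.mem_erase, not_and_or, not_not] at hx hy
      rw [hx.2.resolve_right (not_not.2 hx.1), hy.2.resolve_right (not_not.2 hy.1)]
  refine ⟨P.map Prod.snd, ⟨P, hfst.symm, rfl, hP, ?_⟩, fun c => ?_⟩
  · rw [hcountP _ (by simp)]
    exact (Finset.sum_le_sum fun c _ => Multiset.countP_le_card _ _).trans hℓ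
  · conv_lhs => rw [← hfst]
    rw [avScore_map_fst_eq_add P (fun q hq =>
      (hP q hq).elim (fun h => h ▸ Finset.Subset.refl _) (fun h => h.1)), hcountP _ (by simp)]
    congr 1
    have hne : ∀ a ∈ A, a ≠ c →
        (S a).countP (fun v => c ∈ (v, v.erase a).1 \ (v, v.erase a).2) = 0 := by
      intro a _ hac
      rw [Multiset.countP_eq_zero]
      intro v _ hv
      simp only [Finset.mem_sdiff, Finset.mem_erase] at hv
      exact hv.2 ⟨hac.symm, hv.1⟩
    split_ifs with hc
    · rw [Finset.sum_eq_single_of_mem c hc hne, Multiset.countP_eq_card]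
      intro v hv
      simpa using hmem c hc v hv
    · exact Finset.sum_eq_zero fun a ha => hne a ha fun h => hc (h ▸ ha)

/-- characterization of destructive bribery under AV where at most `ℓ` votes
are selected and exactly one candidate is deleted from each selected vote. Here `s` is the
`k`-th largest AV score among the candidates of `C \ J` (counted with multiplicity). -/
theorem vdc_av_characterization
    (C : Finset α) (V : Multiset (Finset α)) (hV : ∀ v ∈ V, v ⊆ C)
    (J : Finset α) (hJC : J ⊆ C) (hJ : J.Nonempty)
    (k ℓ : ℕ) (hk : 1 ≤ k) (hkC : k ≤ (C \ J).card)
    (s : ℕ)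
    (hs1 : k ≤ ((C \ J).filter fun c => s ≤ avScore V c).card)
    (hs2 : ((C \ J).filter fun c => s < avScore V c).card < k) :
    (∃ V' : Multiset (Finset α),
        VoteDeletionChanges V V' ℓ 1 ∧
        ∀ w, IsWinningCommittee C k (avCom V') w → ∀ c ∈ J, c ∉ w)
    ↔ (∑ c ∈ J.filter (fun c => s ≤ avScore V c), (avScore V c - s + 1) ≤ ℓ ∧
        ∃ S : α → Multiset (Finset α),
          (∑ c ∈ J.filter (fun c => s ≤ avScore V c), S c) ≤ V ∧
          ∀ c ∈ J.filter (fun c => s ≤ avScore V c),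
            (∀ v ∈ S c, c ∈ v) ∧ Multiset.card (S c) = avScore V c - s + 1) := by
  constructor
  · rintro ⟨V', hV', hwin⟩
    have hkC' : k ≤ C.card := hkC.trans (Finset.card_le_card Finset.sdiff_subset)
    have hmono : ∀ c, avScore V' c ≤ avScore V c := by
      obtain ⟨P, rfl, rfl, hP, -⟩ := hV'
      intro c
      rw [avScore_map_fst_eq_add P (fun q hq =>
        (hP q hq).elim (fun h => h ▸ Finset.Subset.refl _) (fun h => h.1))]
      exact Nat.le_add_right _ _
    have hlt : ∀ c ∈ J, avScore V' c < s := by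
      intro c hc
      by_contra! hle
      refine absurd ((le_card_filter_avScore_lt hJC hkC' hwin hc).trans
        (Finset.card_le_card ?_)) hs2.not_ge
      exact Finset.monotone_filter_right _ fun d _ hd => (hle.trans_lt hd).trans_le (hmono d)
    refine hV'.exists_deletions _ _ fun c hc => ?_
    obtain ⟨hcJ, hsc⟩ := Finset.mem_filter.1 hc
    have := hlt c hcJ
    omega
  · rintro ⟨hℓ, S, hS, hSc⟩
    obtain ⟨V', hV', hscore⟩ := exists_voteDeletionChanges _ S hS (fun c hc => (hSc c hc).1)
      ((Finset.sum_congr rfl fun c hc => (hSc c hc).2).trans_le hℓ)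
    refine ⟨V', hV', fun w hw c hcJ hcw => ?_⟩
    have hlt : avScore V' c < s := by
      have h1 := hscore c
      split_ifs at h1 with hc
      · rw [(hSc c hc).2] at h1
        omega
      · rw [Finset.mem_filter, not_and, not_le] at hc
        exact (Nat.le_add_right _ _).trans_lt (h1 ▸ hc hcJ)
    have hcard : (w.erase c).card < ((C \ J).filter fun d => s ≤ avScore V d).card := by
      rw [Finset.card_erase_of_mem hcw, hw.2.1]
      omega
    obtain ⟨d, hd, hdw⟩ := Finset.exists_mem_notMem_of_card_lt_card hcard
    rw [Finset.mem_filter, Finset.mem_sdiff] at hd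
    obtain ⟨⟨hdC, hdJ⟩, hsd⟩ := hd
    have hdw' : d ∉ w := fun h => hdw (Finset.mem_erase.2 ⟨fun h => hdJ (h ▸ hcJ), h⟩)
    have h1 := hscore d
    rw [if_neg fun h => hdJ (Finset.mem_filter.1 h).1] at h1
    have h2 := hw.avScore_le hcw hdw' hdC
    omega

end ApprovalBribery
end
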